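/- Let λ: ℝ → (0,∞) be a smooth function with ∂_r^{j+1} log λ ∈ L^∞(ℝ) for all integers j ≥ 0. Then for every symbol b ∈ S^m_σ(λ), every multiindex Γ = (γ₀,γ) and every u ∈ C_c^∞(ℝ^n), one has (λ^{-1}D_θ)^γ D_r^{γ₀} Op(b)u = Op((λ^{-1}η + λ^{-1}D_θ)^γ (ρ + D_r)^{γ₀} b)u, and the composed symbol (λ^{-1}η + λ^{-1}D_θ)^γ (ρ + D_r)^{γ₀} b belongs to S^{m+|Γ|}_σ(λ). -/

import Mathlib

open MeasureTheory Real
open scoped BigOperators Classical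

noncomputable section

/-- Points of `ℝⁿ`. The coordinate `q 0` plays the role of the radial variable `r`,
the remaining coordinates are the angular variables `θ`. -/
abbrev Vec (n : ℕ) := Fin n → ℝ

/-- Complex-valued partial derivative in the coordinate direction `i`. -/
def pdC {n : ℕ} (i : Fin n) (f : Vec n → ℂ) : Vec n → ℂ :=
  fun x => fderiv ℝ f x (Pi.single i 1)

/-- Iterated (multiindex) partial derivative `∂^A f`. -/
def mpd {n : ℕ} (A : Fin n → ℕ) (f : Vec n → ℂ) : Vec n → ℂ :=
  (List.finRange n).foldr (fun i g => (pdC i)^[A i] g) f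

/-- Real-valued partial derivative in the coordinate direction `i`. -/
def pdR {n : ℕ} (i : Fin n) (f : Vec n → ℝ) : Vec n → ℝ :=
  fun x => fderiv ℝ f x (Pi.single i 1)

/-- Iterated (multiindex) partial derivative, real valued. -/
def mpdR {n : ℕ} (A : Fin n → ℕ) (f : Vec n → ℝ) : Vec n → ℝ :=
  (List.finRange n).foldr (fun i g => (pdR i)^[A i] g) f

/-- Total length `|A| = α₀ + |α|` of a multiindex. -/
def fullLen {n : ℕ} (A : Fin n → ℕ) : ℕ := ∑ i, A i

/-- Angular length `|α|` of a multiindex `A = (α₀, α)`. -/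
def angLen {n : ℕ} [NeZero n] (A : Fin n → ℕ) : ℕ := ∑ i, if i = 0 then 0 else A i

/-- The weighted Japanese bracket `⟨ρ ⊕ μ⁻¹ η⟩ = (1 + ρ² + μ⁻²|η|²)^(1/2)`,
where `ρ = p 0` and `η` are the remaining coordinates of `p`. -/
def jbr {n : ℕ} [NeZero n] (μ : ℝ) (p : Vec n) : ℝ :=
  Real.sqrt (1 + ∑ i, (if i = 0 then p i else μ⁻¹ * p i) ^ 2)

/-- Derivative `∂_q^A` of a function `a(q, p)` in the first slot. -/
def dqS {n : ℕ} (A : Fin n → ℕ) (a : Vec n → Vec n → ℂ) : Vec n → Vec n → ℂ :=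
  fun q p => mpd A (fun x => a x p) q

/-- Derivative `∂_p^B` of a function `a(q, p)` in the second slot. -/
def dpS {n : ℕ} (B : Fin n → ℕ) (a : Vec n → Vec n → ℂ) : Vec n → Vec n → ℂ :=
  fun q p => mpd B (fun x => a q x) p

/-- Derivative `∂_q^A` of a function `a(q, p, q')` in the first slot. -/
def d1B {n : ℕ} (A : Fin n → ℕ) (a : Vec n → Vec n → Vec n → ℂ) :
    Vec n → Vec n → Vec n → ℂ :=
  fun q p q' => mpd A (fun x => a x p q') q

/-- Derivative `∂_p^B` of a function `a(q, p, q')` in the second slot. -/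
def d2B {n : ℕ} (B : Fin n → ℕ) (a : Vec n → Vec n → Vec n → ℂ) :
    Vec n → Vec n → Vec n → ℂ :=
  fun q p q' => mpd B (fun x => a q x q') p

/-- Derivative `∂_{q'}^{A'}` of a function `a(q, p, q')` in the third slot. -/
def d3B {n : ℕ} (A' : Fin n → ℕ) (a : Vec n → Vec n → Vec n → ℂ) :
    Vec n → Vec n → Vec n → ℂ :=
  fun q p q' => mpd A' (fun x => a q p x) q'

/-- The admissibility condition for the weight `λ : ℝ → (0,∞)`:
`λ` is positive and `C₀⁻¹ ≤ λ(r)/λ(r') ≤ C₀` whenever `|r - r'| ≤ 1`. -/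
def Admissible (lam : ℝ → ℝ) : Prop :=
  (∀ r, 0 < lam r) ∧
  ∃ C > 0, ∀ r r' : ℝ, |r - r'| ≤ 1 → C⁻¹ ≤ lam r / lam r' ∧ lam r / lam r' ≤ C

/-- The symbol class `S^m_σ(λ)`:  `a` is smooth on `ℝ^{2n}` and for all multiindices
`A = (α₀, α)`, `B = (β₀, β)`,
`|(λ(r)⁻¹∂_θ)^α (λ(r)∂_η)^β ∂_r^{α₀} ∂_ρ^{β₀} a(q,p)| ≤ C ⟨ρ ⊕ λ(r)⁻¹η⟩^{m - σ|B|}`.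
(The weights `λ(r)^{±1}` commute with the `θ`- and `η`-derivatives, so the weighted
derivative equals `λ(r)^{|β| - |α|}` times the plain mixed partial derivative.) -/
def IsSymbol {n : ℕ} [NeZero n] (lam : ℝ → ℝ) (m σ : ℝ) (a : Vec n → Vec n → ℂ) : Prop :=
  ContDiff ℝ (⊤ : ℕ∞) (fun x : Vec n × Vec n => a x.1 x.2) ∧
  ∀ A B : Fin n → ℕ, ∃ C > 0, ∀ q p : Vec n,
    lam (q 0) ^ ((angLen B : ℤ) - (angLen A : ℤ)) * ‖dqS A (dpS B a) q p‖
      ≤ C * jbr (lam (q 0)) p ^ (m - σ * (fullLen B : ℝ))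

/-- The seminorm `|a|_{λ : M, m, σ}` on the symbol class `S^m_σ(λ)`. -/
def symSeminorm {n : ℕ} [NeZero n] (lam : ℝ → ℝ) (M : ℕ) (m σ : ℝ)
    (a : Vec n → Vec n → ℂ) : ℝ :=
  ∑ A : Fin n → Fin (M + 1), ∑ B : Fin n → Fin (M + 1),
    if fullLen (fun i => (A i : ℕ)) + fullLen (fun i => (B i : ℕ)) ≤ M then
      ⨆ q : Vec n, ⨆ p : Vec n,
        jbr (lam (q 0)) p ^ (-m + σ * (fullLen (fun i => (B i : ℕ)) : ℝ)) *
          (lam (q 0) ^ ((angLen (fun i => (B i : ℕ)) : ℤ) - (angLen (fun i => (A i : ℕ)) : ℤ)) *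
            ‖dqS (fun i => (A i : ℕ)) (dpS (fun i => (B i : ℕ)) a) q p‖)
    else 0

/-- `λ^t_{jk} := λ(tj + (1-t)k)`. -/
def lamT (lam : ℝ → ℝ) (t : ℝ) (j k : ℤ) : ℝ := lam (t * j + (1 - t) * k)

/-- The bisymbol class `BS^m_σ(λ; t)`. -/
def IsBisymbol {n : ℕ} [NeZero n] (lam : ℝ → ℝ) (m σ t : ℝ)
    (a : Vec n → Vec n → Vec n → ℂ) : Prop :=
  ContDiff ℝ (⊤ : ℕ∞) (fun x : Vec n × Vec n × Vec n => a x.1 x.2.1 x.2.2) ∧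
  ∀ A B A' : Fin n → ℕ, ∃ C > 0, ∀ (j k : ℤ) (q p q' : Vec n),
    |q 0 - (j : ℝ)| ≤ 1 → |q' 0 - (k : ℝ)| ≤ 1 →
    lamT lam t j k ^ ((angLen B : ℤ) - (angLen A : ℤ) - (angLen A' : ℤ)) *
        ‖d1B A (d2B B (d3B A' a)) q p q'‖
      ≤ C * jbr (lamT lam t j k) p ^ (m - σ * (fullLen B : ℝ))

/-- The seminorm `|a|_{λ : M, m, σ, t}` on `BS^m_σ(λ; t)`. -/
def bisymSeminorm {n : ℕ} [NeZero n] (lam : ℝ → ℝ) (M : ℕ) (m σ t : ℝ)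
    (a : Vec n → Vec n → Vec n → ℂ) : ℝ :=
  ∑ A : Fin n → Fin (M + 1), ∑ B : Fin n → Fin (M + 1), ∑ A' : Fin n → Fin (M + 1),
    if fullLen (fun i => (A i : ℕ)) + fullLen (fun i => (B i : ℕ))
        + fullLen (fun i => (A' i : ℕ)) ≤ M then
      ⨆ j : ℤ, ⨆ k : ℤ, ⨆ q : Vec n, ⨆ p : Vec n, ⨆ q' : Vec n,
        if |q 0 - (j : ℝ)| ≤ 1 ∧ |q' 0 - (k : ℝ)| ≤ 1 then
          jbr (lamT lam t j k) p ^ (-m + σ * (fullLen (fun i => (B i : ℕ)) : ℝ)) *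
            (lamT lam t j k ^ ((angLen (fun i => (B i : ℕ)) : ℤ)
                - (angLen (fun i => (A i : ℕ)) : ℤ) - (angLen (fun i => (A' i : ℕ)) : ℤ)) *
              ‖d1B (fun i => (A i : ℕ)) (d2B (fun i => (B i : ℕ))
                  (d3B (fun i => (A' i : ℕ)) a)) q p q'‖)
        else 0
    else 0

/-- The plain bisymbol class `BS^m_σ(1)` (the case `λ ≡ 1`). -/
def IsBisymbolOne {n : ℕ} [NeZero n] (m σ : ℝ) (a : Vec n → Vec n → Vec n → ℂ) : Prop :=
  ContDiff ℝ (⊤ : ℕ∞) (fun x : Vec n × Vec n × Vec n => a x.1 x.2.1 x.2.2) ∧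
  ∀ A B A' : Fin n → ℕ, ∃ C > 0, ∀ q p q' : Vec n,
    ‖d1B A (d2B B (d3B A' a)) q p q'‖ ≤ C * jbr 1 p ^ (m - σ * (fullLen B : ℝ))

/-- The seminorm `|a|_{M, m, σ}` on `BS^m_σ(1)`. -/
def bisymSeminormOne {n : ℕ} [NeZero n] (M : ℕ) (m σ : ℝ)
    (a : Vec n → Vec n → Vec n → ℂ) : ℝ :=
  ∑ A : Fin n → Fin (M + 1), ∑ B : Fin n → Fin (M + 1), ∑ A' : Fin n → Fin (M + 1),
    if fullLen (fun i => (A i : ℕ)) + fullLen (fun i => (B i : ℕ))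
        + fullLen (fun i => (A' i : ℕ)) ≤ M then
      ⨆ q : Vec n, ⨆ p : Vec n, ⨆ q' : Vec n,
        jbr 1 p ^ (-m + σ * (fullLen (fun i => (B i : ℕ)) : ℝ)) *
          ‖d1B (fun i => (A i : ℕ)) (d2B (fun i => (B i : ℕ))
              (d3B (fun i => (A' i : ℕ)) a)) q p q'‖
    else 0

/-- The oscillatory phase `e^{i p · (q - q')}`. -/
def phase {n : ℕ} (p q q' : Vec n) : ℂ :=
  Complex.exp (Complex.I * ((∑ i, p i * (q i - q' i) : ℝ) : ℂ))

/-- The pseudodifferential operator `Op^g(a)` with bisymbol `a`, as an iterated integral: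
`Op^g(a)u(q) = (2π)^{-n} g(q)^{-1/4} ∫ dp ∫ dq' a(q,p,q') e^{ip⋅(q-q')} u(q') g(q')^{1/4}`. -/
def OpG {n : ℕ} (g : Vec n → ℝ) (a : Vec n → Vec n → Vec n → ℂ) (u : Vec n → ℂ) :
    Vec n → ℂ :=
  fun q => (((2 * Real.pi) ^ (-(n : ℤ)) : ℝ) : ℂ) * ((g q ^ (-(1 : ℝ) / 4) : ℝ) : ℂ) *
    ∫ p : Vec n, ∫ q' : Vec n,
      a q p q' * phase p q q' * u q' * ((g q' ^ ((1 : ℝ) / 4) : ℝ) : ℂ)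

/-- The pseudodifferential operator `Op(a) = Op^1(a)` with bisymbol `a`. -/
def Op {n : ℕ} (a : Vec n → Vec n → Vec n → ℂ) (u : Vec n → ℂ) : Vec n → ℂ :=
  fun q => (((2 * Real.pi) ^ (-(n : ℤ)) : ℝ) : ℂ) *
    ∫ p : Vec n, ∫ q' : Vec n, a q p q' * phase p q q' * u q'

/-- The `t`-quantization `Op^{g,t}(a)` of a symbol `a`. -/
def OpSt {n : ℕ} (g : Vec n → ℝ) (t : ℝ) (a : Vec n → Vec n → ℂ) (u : Vec n → ℂ) :
    Vec n → ℂ :=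
  OpG g (fun q p q' => a (t • q + (1 - t) • q') p) u

/-- The quantization `Op(b)` of a symbol `b` (the case `t = 1`, `g ≡ 1`). -/
def OpSym {n : ℕ} (b : Vec n → Vec n → ℂ) (u : Vec n → ℂ) : Vec n → ℂ :=
  Op (fun q p _ => b q p) u

/-- The `L²(g^{1/2}dq)` norm. -/
def L2g {n : ℕ} (g : Vec n → ℝ) (f : Vec n → ℂ) : ℝ :=
  Real.sqrt (∫ q : Vec n, ‖f q‖ ^ 2 * Real.sqrt (g q))

/-- The `L²(dq)` norm. -/
def L2 {n : ℕ} (f : Vec n → ℂ) : ℝ :=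
  Real.sqrt (∫ q : Vec n, ‖f q‖ ^ 2)

end

noncomputable section

/-- Assumption 4.2: `λ : ℝ → (0,∞)` is smooth and `∂_r^{j+1} log λ ∈ L^∞(ℝ)` for all `j ≥ 0`. -/
def LogDerBounded (lam : ℝ → ℝ) : Prop :=
  (∀ r, 0 < lam r) ∧ ContDiff ℝ (⊤ : ℕ∞) lam ∧
  ∀ j : ℕ, ∃ C : ℝ, ∀ r : ℝ, |iteratedDeriv (j + 1) (fun s => Real.log (lam s)) r| ≤ C

/-- The weighted differential monomial `(λ⁻¹ D_θ)^γ D_r^{γ₀}`, where `D = i⁻¹ ∂` and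
`Γ = (γ₀, γ)`; since `λ` depends only on `r = q 0`, this equals
`λ(r)^{-|γ|} i^{-|Γ|} ∂^Γ`. -/
def wDf {n : ℕ} [NeZero n] (lam : ℝ → ℝ) (Γ : Fin n → ℕ) (f : Vec n → ℂ) : Vec n → ℂ :=
  fun q => ((lam (q 0) ^ (-(angLen Γ : ℤ)) : ℝ) : ℂ) * Complex.I ^ (-(fullLen Γ : ℤ)) *
    mpd Γ f q

/-- The operator `ρ + D_r` acting on symbols `b(q,p)` (`ρ = p 0`). -/
def opRho {n : ℕ} [NeZero n] (b : Vec n → Vec n → ℂ) : Vec n → Vec n → ℂ :=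
  fun q p => ((p 0 : ℝ) : ℂ) * b q p + Complex.I⁻¹ * dqS (Pi.single 0 1) b q p

/-- The operator `λ⁻¹ η_i + λ⁻¹ D_{θ_i}` acting on symbols `b(q,p)`. -/
def opEta {n : ℕ} [NeZero n] (lam : ℝ → ℝ) (i : Fin n) (b : Vec n → Vec n → ℂ) :
    Vec n → Vec n → ℂ :=
  fun q p => (((lam (q 0))⁻¹ * p i : ℝ) : ℂ) * b q p +
    (((lam (q 0))⁻¹ : ℝ) : ℂ) * Complex.I⁻¹ * dqS (Pi.single i 1) b q p

/-- The composed symbol `(λ⁻¹η + λ⁻¹D_θ)^γ (ρ + D_r)^{γ₀} b`. -/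
def compSym {n : ℕ} [NeZero n] (lam : ℝ → ℝ) (Γ : Fin n → ℕ) (b : Vec n → Vec n → ℂ) :
    Vec n → Vec n → ℂ :=
  (List.finRange n).foldr (fun i g => if i = 0 then g else (opEta lam i)^[Γ i] g)
    ((opRho)^[Γ 0] b)

end

section FoldIterate

variable {X : Type*} {n : ℕ}

theorem iterate_apply_comm {S : X → Prop} {f g : X → X} (hf : ∀ a, S a → S (f a))
    (hc : ∀ a, S a → g (f a) = f (g a)) (k : ℕ) {a : X} (ha : S a) :
    g (f^[k] a) = f^[k] (g a) ∧ S (f^[k] a) := by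
  induction k with
  | zero => exact ⟨rfl, ha⟩
  | succ k ih =>
    simp only [Function.iterate_succ_apply']
    exact ⟨by rw [hc _ ih.2, ih.1], hf _ ih.2⟩

variable {S : X → Prop} {D : Fin n → X → X}

theorem foldr_iterate_mem (hS : ∀ i a, S a → S (D i a)) (A : Fin n → ℕ) (l : List (Fin n))
    {a : X} (ha : S a) : S (l.foldr (fun j g => (D j)^[A j] g) a) := by
  induction l with
  | nil => exact ha
  | cons j l ih => exact (iterate_apply_comm (g := id) (hS j) (fun _ _ => rfl) (A j) ih).2

theorem foldr_iterate_comm (hS : ∀ i a, S a → S (D i a)) (i : Fin n)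
    (hc : ∀ j a, S a → D i (D j a) = D j (D i a)) (A : Fin n → ℕ) (l : List (Fin n))
    {a : X} (ha : S a) :
    D i (l.foldr (fun j g => (D j)^[A j] g) a) = l.foldr (fun j g => (D j)^[A j] g) (D i a) ∧
      S (l.foldr (fun j g => (D j)^[A j] g) a) := by
  induction l with
  | nil => exact ⟨rfl, ha⟩
  | cons j l ih =>
    obtain ⟨h1, h2⟩ := iterate_apply_comm (hS j) (hc j) (A j) ih.2
    exact ⟨by simp only [List.foldr_cons]; rw [h1, ih.1], h2⟩

theorem foldr_iterate_add_single (hS : ∀ i a, S a → S (D i a))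
    (hc : ∀ i j a, S a → D i (D j a) = D j (D i a)) (A : Fin n → ℕ) (i : Fin n)
    (l : List (Fin n)) (hl : l.Nodup) {a : X} (ha : S a) :
    l.foldr (fun j g => (D j)^[(A + Pi.single i 1 : Fin n → ℕ) j] g) a =
      l.foldr (fun j g => (D j)^[A j] g) (if i ∈ l then D i a else a) := by
  induction l with
  | nil => simp
  | cons j l ih =>
    obtain ⟨hj, hl⟩ := List.nodup_cons.1 hl
    simp only [List.foldr_cons]
    rw [ih hl]
    by_cases hij : i = j
    · subst hij
      obtain ⟨h1, h2⟩ := foldr_iterate_comm hS i (hc i) A l ha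
      simp only [hj, if_false, List.mem_cons, true_or, if_true, Pi.add_apply, Pi.single_eq_same,
        Function.iterate_succ_apply]
      rw [h1]
    · simp [hij]

end FoldIterate

section DirectionalDerivative

variable {E : Type*} [NormedAddCommGroup E] [NormedSpace ℝ E]

theorem contDiff_fderiv_apply_const {F : E → ℂ} (hF : ContDiff ℝ (⊤ : ℕ∞) F) (v : E) :
    ContDiff ℝ (⊤ : ℕ∞) (fun x => fderiv ℝ F x v) :=
  (hF.fderiv_right (m := (⊤ : ℕ∞)) (by simp)).clm_apply contDiff_const

theorem fderiv_fderiv_apply_comm {F : E → ℂ} (hF : ContDiff ℝ (⊤ : ℕ∞) F) (v w x : E) :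
    fderiv ℝ (fun y => fderiv ℝ F y w) x v = fderiv ℝ (fun y => fderiv ℝ F y v) x w := by
  have hd : DifferentiableAt ℝ (fderiv ℝ F) x :=
    (hF.fderiv_right (m := (⊤ : ℕ∞)) (by simp)).contDiffAt.differentiableAt (by simp)
  have key : ∀ z : E, fderiv ℝ (fun y => fderiv ℝ F y z) x = (fderiv ℝ (fderiv ℝ F) x).flip z := by
    intro z
    rw [fderiv_clm_apply hd (differentiableAt_const _)]
    simp
  rw [key, key]
  have hs : IsSymmSndFDerivAt ℝ F x :=
    hF.contDiffAt.isSymmSndFDerivAt (by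
      rw [minSmoothness_of_isRCLikeNormedField]
      exact WithTop.coe_le_coe.2 (le_top : (2 : ℕ∞) ≤ ⊤))
  exact hs v w

end DirectionalDerivative

section Slots

variable {n : ℕ}

/-- Joint smoothness of a function `a(q, p)`. -/
def JointSmooth (a : Vec n → Vec n → ℂ) : Prop :=
  ContDiff ℝ (⊤ : ℕ∞) (fun x : Vec n × Vec n => a x.1 x.2)

/-- The partial derivative `∂_{q_i}` of `a(q, p)`. -/
noncomputable def dq1 (i : Fin n) (a : Vec n → Vec n → ℂ) : Vec n → Vec n → ℂ :=
  fun q p => pdC i (fun x => a x p) q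

/-- The partial derivative `∂_{p_i}` of `a(q, p)`. -/
noncomputable def dp1 (i : Fin n) (a : Vec n → Vec n → ℂ) : Vec n → Vec n → ℂ :=
  fun q p => pdC i (fun x => a q x) p

theorem JointSmooth.left {a : Vec n → Vec n → ℂ} (ha : JointSmooth a) (p : Vec n) :
    ContDiff ℝ (⊤ : ℕ∞) (fun q => a q p) :=
  ha.comp (contDiff_id.prodMk contDiff_const)

theorem JointSmooth.right {a : Vec n → Vec n → ℂ} (ha : JointSmooth a) (q : Vec n) :
    ContDiff ℝ (⊤ : ℕ∞) (fun p => a q p) :=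
  ha.comp (contDiff_const.prodMk contDiff_id)

theorem dq1_eq {a : Vec n → Vec n → ℂ} (ha : JointSmooth a) (i : Fin n) :
    dq1 i a = fun q p =>
      fderiv ℝ (fun x : Vec n × Vec n => a x.1 x.2) (q, p) (Pi.single i 1, 0) := by
  funext q p
  have h1 : HasFDerivAt (fun x : Vec n × Vec n => a x.1 x.2) _ (q, p) :=
    (ha.contDiffAt.differentiableAt (by simp)).hasFDerivAt
  have h2 : HasFDerivAt (fun x : Vec n => (x, p)) (ContinuousLinearMap.inl ℝ (Vec n) (Vec n)) q :=
    hasFDerivAt_prodMk_left q p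
  have h3 := HasFDerivAt.comp q h1 h2
  have h4 := h3.fderiv
  simp only [Function.comp_def] at h4
  simp [dq1, pdC, h4]

theorem dp1_eq {a : Vec n → Vec n → ℂ} (ha : JointSmooth a) (i : Fin n) :
    dp1 i a = fun q p =>
      fderiv ℝ (fun x : Vec n × Vec n => a x.1 x.2) (q, p) (0, Pi.single i 1) := by
  funext q p
  have h1 : HasFDerivAt (fun x : Vec n × Vec n => a x.1 x.2) _ (q, p) :=
    (ha.contDiffAt.differentiableAt (by simp)).hasFDerivAt
  have h2 : HasFDerivAt (fun x : Vec n => (q, x)) (ContinuousLinearMap.inr ℝ (Vec n) (Vec n)) p :=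
    hasFDerivAt_prodMk_right q p
  have h3 := HasFDerivAt.comp p h1 h2
  have h4 := h3.fderiv
  simp only [Function.comp_def] at h4
  simp [dp1, pdC, h4]

theorem JointSmooth.dq1 {a : Vec n → Vec n → ℂ} (ha : JointSmooth a) (i : Fin n) :
    JointSmooth (dq1 i a) := by
  rw [dq1_eq ha]
  exact contDiff_fderiv_apply_const ha _

theorem JointSmooth.dp1 {a : Vec n → Vec n → ℂ} (ha : JointSmooth a) (i : Fin n) :
    JointSmooth (dp1 i a) := by
  rw [dp1_eq ha]
  exact contDiff_fderiv_apply_const ha _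

theorem dq1_dq1_comm {a : Vec n → Vec n → ℂ} (ha : JointSmooth a) (i j : Fin n) :
    dq1 i (dq1 j a) = dq1 j (dq1 i a) := by
  rw [dq1_eq (ha.dq1 j), dq1_eq (ha.dq1 i), dq1_eq ha, dq1_eq ha]
  funext q p
  exact fderiv_fderiv_apply_comm ha _ _ _

theorem dp1_dp1_comm {a : Vec n → Vec n → ℂ} (ha : JointSmooth a) (i j : Fin n) :
    dp1 i (dp1 j a) = dp1 j (dp1 i a) := by
  rw [dp1_eq (ha.dp1 j), dp1_eq (ha.dp1 i), dp1_eq ha, dp1_eq ha]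
  funext q p
  exact fderiv_fderiv_apply_comm ha _ _ _

theorem dq1_dp1_comm {a : Vec n → Vec n → ℂ} (ha : JointSmooth a) (i j : Fin n) :
    dq1 i (dp1 j a) = dp1 j (dq1 i a) := by
  rw [dq1_eq (ha.dp1 j), dp1_eq (ha.dq1 i), dp1_eq ha, dq1_eq ha]
  funext q p
  exact fderiv_fderiv_apply_comm ha _ _ _

theorem pdC_iterate_left (i : Fin n) (k : ℕ) (a : Vec n → Vec n → ℂ) (p : Vec n) :
    (pdC i)^[k] (fun x => a x p) = fun x => ((dq1 i)^[k] a) x p := by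
  induction k with
  | zero => rfl
  | succ k ih => simp only [Function.iterate_succ_apply', ih]; rfl

theorem pdC_iterate_right (i : Fin n) (k : ℕ) (a : Vec n → Vec n → ℂ) (q : Vec n) :
    (pdC i)^[k] (fun x => a q x) = fun x => ((dp1 i)^[k] a) q x := by
  induction k with
  | zero => rfl
  | succ k ih => simp only [Function.iterate_succ_apply', ih]; rfl

theorem dqS_eq_foldr (A : Fin n → ℕ) (a : Vec n → Vec n → ℂ) :
    dqS A a = (List.finRange n).foldr (fun i g => (dq1 i)^[A i] g) a := by
  have key : ∀ (l : List (Fin n)) (p : Vec n), l.foldr (fun i g => (pdC i)^[A i] g)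
      (fun x => a x p) = fun x => (l.foldr (fun i g => (dq1 i)^[A i] g) a) x p := by
    intro l p
    induction l with
    | nil => rfl
    | cons i l ih => rw [List.foldr_cons, List.foldr_cons, ih, pdC_iterate_left]
  funext q p
  exact congrFun (key _ p) q

theorem dpS_eq_foldr (B : Fin n → ℕ) (a : Vec n → Vec n → ℂ) :
    dpS B a = (List.finRange n).foldr (fun i g => (dp1 i)^[B i] g) a := by
  have key : ∀ (l : List (Fin n)) (q : Vec n), l.foldr (fun i g => (pdC i)^[B i] g)
      (fun x => a q x) = fun x => (l.foldr (fun i g => (dp1 i)^[B i] g) a) q x := by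
    intro l q
    induction l with
    | nil => rfl
    | cons i l ih => rw [List.foldr_cons, List.foldr_cons, ih, pdC_iterate_right]
  funext q p
  exact congrFun (key _ q) p

theorem JointSmooth.dpS {a : Vec n → Vec n → ℂ} (ha : JointSmooth a) (B : Fin n → ℕ) :
    JointSmooth (dpS B a) := by
  rw [dpS_eq_foldr]
  exact foldr_iterate_mem (S := JointSmooth) (fun i a ha => ha.dp1 i) B _ ha

theorem dqS_dq1 {a : Vec n → Vec n → ℂ} (ha : JointSmooth a) (A : Fin n → ℕ) (i : Fin n) :
    dqS A (dq1 i a) = dqS (A + Pi.single i 1) a := by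
  rw [dqS_eq_foldr, dqS_eq_foldr, foldr_iterate_add_single (S := JointSmooth)
    (fun i a ha => ha.dq1 i) (fun i j a ha => dq1_dq1_comm ha i j) A i _
    (List.nodup_finRange n) ha]
  simp

theorem dpS_dp1 {a : Vec n → Vec n → ℂ} (ha : JointSmooth a) (B : Fin n → ℕ) (i : Fin n) :
    dpS B (dp1 i a) = dpS (B + Pi.single i 1) a := by
  rw [dpS_eq_foldr, dpS_eq_foldr, foldr_iterate_add_single (S := JointSmooth)
    (fun i a ha => ha.dp1 i) (fun i j a ha => dp1_dp1_comm ha i j) B i _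
    (List.nodup_finRange n) ha]
  simp

theorem dpS_dq1 {a : Vec n → Vec n → ℂ} (ha : JointSmooth a) (B : Fin n → ℕ) (i : Fin n) :
    dpS B (dq1 i a) = dq1 i (dpS B a) := by
  have key : ∀ l : List (Fin n), dq1 i (l.foldr (fun j g => (dp1 j)^[B j] g) a) =
      l.foldr (fun j g => (dp1 j)^[B j] g) (dq1 i a) ∧
      JointSmooth (l.foldr (fun j g => (dp1 j)^[B j] g) a) := by
    intro l
    induction l with
    | nil => exact ⟨rfl, ha⟩
    | cons j l ih =>
      obtain ⟨h1, h2⟩ := iterate_apply_comm (S := JointSmooth) (f := dp1 j) (g := dq1 i)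
        (fun a ha => ha.dp1 j) (fun a ha => dq1_dp1_comm ha i j) (B j) ih.2
      exact ⟨by simp only [List.foldr_cons]; rw [h1, ih.1], h2⟩
  rw [dpS_eq_foldr, dpS_eq_foldr, (key _).1]

theorem dqS_zero (a : Vec n → Vec n → ℂ) : dqS 0 a = a := by
  rw [dqS_eq_foldr]
  induction List.finRange n with
  | nil => rfl
  | cons i l ih => rw [List.foldr_cons, ih]; rfl

theorem dpS_zero (a : Vec n → Vec n → ℂ) : dpS 0 a = a := by
  rw [dpS_eq_foldr]
  induction List.finRange n with
  | nil => rfl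
  | cons i l ih => rw [List.foldr_cons, ih]; rfl

theorem dqS_single {a : Vec n → Vec n → ℂ} (ha : JointSmooth a) (i : Fin n) :
    dqS (Pi.single i 1) a = dq1 i a := by
  rw [← zero_add (Pi.single i 1), ← dqS_dq1 ha, dqS_zero]

end Slots
section PartialDerivative

variable {n : ℕ}

theorem pdC_add {f g : Vec n → ℂ} (hf : ContDiff ℝ (⊤ : ℕ∞) f) (hg : ContDiff ℝ (⊤ : ℕ∞) g)
    (i : Fin n) (x : Vec n) : pdC i (fun y => f y + g y) x = pdC i f x + pdC i g x := by
  unfold pdC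
  rw [fderiv_fun_add (hf.contDiffAt.differentiableAt (by simp))
    (hg.contDiffAt.differentiableAt (by simp))]
  rfl

theorem pdC_mul {f g : Vec n → ℂ} (hf : ContDiff ℝ (⊤ : ℕ∞) f) (hg : ContDiff ℝ (⊤ : ℕ∞) g)
    (i : Fin n) (x : Vec n) :
    pdC i (fun y => f y * g y) x = pdC i f x * g x + f x * pdC i g x := by
  unfold pdC
  rw [fderiv_fun_mul (hf.contDiffAt.differentiableAt (by simp))
    (hg.contDiffAt.differentiableAt (by simp))]
  simp
  ring

theorem pdC_const (c : ℂ) (i : Fin n) (x : Vec n) : pdC i (fun _ => c) x = 0 := by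
  simp [pdC]

theorem pdC_coord (i j : Fin n) (x : Vec n) :
    pdC j (fun y : Vec n => ((y i : ℝ) : ℂ)) x = if i = j then 1 else 0 := by
  have h : HasFDerivAt (fun y : Vec n => ((y i : ℝ) : ℂ))
      (Complex.ofRealCLM.comp (ContinuousLinearMap.proj (R := ℝ) (φ := fun _ : Fin n => ℝ) i)) x :=
    (Complex.ofRealCLM.comp
      (ContinuousLinearMap.proj (R := ℝ) (φ := fun _ : Fin n => ℝ) i)).hasFDerivAt
  rw [pdC, h.fderiv]
  by_cases hij : i = j
  · subst hij; simp
  · simp [hij]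

theorem contDiff_coord (i : Fin n) :
    ContDiff ℝ (⊤ : ℕ∞) (fun y : Vec n => ((y i : ℝ) : ℂ)) :=
  Complex.ofRealCLM.contDiff.comp (contDiff_apply ℝ ℝ i)

end PartialDerivative

section Bracket

variable {n : ℕ} [NeZero n]

theorem one_le_jbr (μ : ℝ) (p : Vec n) : 1 ≤ jbr μ p := by
  rw [jbr, Real.one_le_sqrt]
  have : 0 ≤ ∑ i, (if i = 0 then p i else μ⁻¹ * p i) ^ 2 :=
    Finset.sum_nonneg fun i _ => sq_nonneg _
  linarith

theorem jbr_pos (μ : ℝ) (p : Vec n) : 0 < jbr μ p := one_pos.trans_le (one_le_jbr μ p)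

/-- The weight exponent of the coordinate direction `i`: `0` for the radial variable,
`1` for an angular one. -/
def angWt (i : Fin n) : ℤ := if i = 0 then 0 else 1

theorem zpow_angWt_mul_abs_le_jbr {μ : ℝ} (hμ : 0 < μ) (p : Vec n) (i : Fin n) :
    μ ^ (-angWt i) * |p i| ≤ jbr μ p := by
  have h : μ ^ (-angWt i) * |p i| = |if i = 0 then p i else μ⁻¹ * p i| := by
    unfold angWt
    split_ifs
    · simp
    · rw [abs_mul, abs_of_pos (inv_pos.2 hμ), zpow_neg_one]
  rw [h, jbr]
  apply Real.abs_le_sqrt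
  have := Finset.single_le_sum (f := fun i : Fin n => (if i = 0 then p i else μ⁻¹ * p i) ^ 2)
    (fun i _ => sq_nonneg _) (Finset.mem_univ i)
  linarith

end Bracket

section Multiindex

variable {n : ℕ}

theorem fullLen_add_single (A : Fin n → ℕ) (i : Fin n) :
    fullLen (A + Pi.single i 1) = fullLen A + 1 := by
  simp [fullLen, Finset.sum_add_distrib]

variable [NeZero n]

theorem angLen_eq_sum (A : Fin n → ℕ) : (angLen A : ℤ) = ∑ i, A i * angWt i := by
  simp only [angLen, angWt, Nat.cast_sum]
  refine Finset.sum_congr rfl fun i _ => ?_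
  split_ifs <;> simp

theorem angLen_add_single (A : Fin n → ℕ) (i : Fin n) :
    (angLen (A + Pi.single i 1) : ℤ) = angLen A + angWt i := by
  simp only [angLen_eq_sum, Pi.add_apply, Nat.cast_add, add_mul, Finset.sum_add_distrib]
  congr 1
  rw [Finset.sum_eq_single i (fun j _ hj => by simp [Pi.single_eq_of_ne hj]) (by simp)]
  simp

end Multiindex

section SymbolCalculus

variable {n : ℕ} [NeZero n] {lam : ℝ → ℝ} {σ : ℝ}

/-- `a` is jointly smooth and `λ(r)^k |a(q, p)| ≤ C ⟨ρ ⊕ λ(r)⁻¹η⟩^m`. -/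
def WeightedBound (lam : ℝ → ℝ) (k : ℤ) (m : ℝ) (a : Vec n → Vec n → ℂ) : Prop :=
  JointSmooth a ∧ ∃ C > 0, ∀ q p : Vec n,
    lam (q 0) ^ k * ‖a q p‖ ≤ C * jbr (lam (q 0)) p ^ m

/-- The symbol estimates of `λ(r)^k a ∈ S^m_σ(λ)` for derivatives of order at most `N`. -/
def FiniteSymbol (lam : ℝ → ℝ) (σ : ℝ) : ℕ → ℤ → ℝ → (Vec n → Vec n → ℂ) → Prop
  | 0, k, m, a => WeightedBound lam k m a
  | N + 1, k, m, a => WeightedBound lam k m a ∧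
      ∀ i, FiniteSymbol lam σ N (k - angWt i) m (dq1 i a) ∧
        FiniteSymbol lam σ N (k + angWt i) (m - σ) (dp1 i a)

theorem FiniteSymbol.weightedBound {N : ℕ} {k : ℤ} {m : ℝ} {a : Vec n → Vec n → ℂ}
    (h : FiniteSymbol lam σ N k m a) : WeightedBound lam k m a := by
  cases N with
  | zero => exact h
  | succ N => exact h.1

theorem FiniteSymbol.smooth {N : ℕ} {k : ℤ} {m : ℝ} {a : Vec n → Vec n → ℂ}
    (h : FiniteSymbol lam σ N k m a) : JointSmooth a := h.weightedBound.1

theorem FiniteSymbol.of_succ {N : ℕ} {k : ℤ} {m : ℝ} {a : Vec n → Vec n → ℂ}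
    (h : FiniteSymbol lam σ (N + 1) k m a) : FiniteSymbol lam σ N k m a := by
  induction N generalizing k m a with
  | zero => exact h.1
  | succ N ih => exact ⟨h.1, fun i => ⟨ih (h.2 i).1, ih (h.2 i).2⟩⟩

theorem FiniteSymbol.mono {N : ℕ} {k : ℤ} {m m' : ℝ} (hm : m ≤ m') {a : Vec n → Vec n → ℂ}
    (h : FiniteSymbol lam σ N k m a) : FiniteSymbol lam σ N k m' a := by
  have key : ∀ {k m m'} {a : Vec n → Vec n → ℂ}, m ≤ m' → WeightedBound lam k m a →
      WeightedBound lam k m' a := by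
    rintro k m m' a hm ⟨hs, C, hC, hb⟩
    refine ⟨hs, C, hC, fun q p => (hb q p).trans ?_⟩
    exact mul_le_mul_of_nonneg_left
      (Real.rpow_le_rpow_of_exponent_le (one_le_jbr _ _) hm) hC.le
  induction N generalizing k m m' a with
  | zero => exact key hm h
  | succ N ih =>
    exact ⟨key hm h.1, fun i => ⟨ih hm (h.2 i).1, ih (by linarith) (h.2 i).2⟩⟩

theorem FiniteSymbol.add (hpos : ∀ r, 0 < lam r) {N : ℕ} {k : ℤ} {m : ℝ}
    {a b : Vec n → Vec n → ℂ} (ha : FiniteSymbol lam σ N k m a)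
    (hb : FiniteSymbol lam σ N k m b) :
    FiniteSymbol lam σ N k m (fun q p => a q p + b q p) := by
  have key : ∀ {k m} {a b : Vec n → Vec n → ℂ}, WeightedBound lam k m a →
      WeightedBound lam k m b → WeightedBound lam k m (fun q p => a q p + b q p) := by
    rintro k m a b ⟨hs, C, hC, h⟩ ⟨hs', C', hC', h'⟩
    refine ⟨hs.add hs', C + C', by positivity, fun q p => ?_⟩
    have := zpow_pos (hpos (q 0)) k
    calc lam (q 0) ^ k * ‖a q p + b q p‖ ≤ lam (q 0) ^ k * (‖a q p‖ + ‖b q p‖) := by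
          gcongr; exact norm_add_le _ _
      _ ≤ _ := by rw [mul_add, add_mul]; exact add_le_add (h q p) (h' q p)
  induction N generalizing k m a b with
  | zero => exact key ha hb
  | succ N ih =>
    refine ⟨key ha.1 hb.1, fun i => ⟨?_, ?_⟩⟩
    · convert ih (ha.2 i).1 (hb.2 i).1 using 3
      exact pdC_add (ha.smooth.left _) (hb.smooth.left _) i _
    · convert ih (ha.2 i).2 (hb.2 i).2 using 3
      exact pdC_add (ha.smooth.right _) (hb.smooth.right _) i _

theorem FiniteSymbol.const_mul {N : ℕ} {k : ℤ} {m : ℝ} (c : ℂ)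
    {a : Vec n → Vec n → ℂ} (ha : FiniteSymbol lam σ N k m a) :
    FiniteSymbol lam σ N k m (fun q p => c * a q p) := by
  have key : ∀ {k m} {a : Vec n → Vec n → ℂ}, WeightedBound lam k m a →
      WeightedBound lam k m (fun q p => c * a q p) := by
    rintro k m a ⟨hs, C, hC, h⟩
    refine ⟨contDiff_const.mul hs, (‖c‖ + 1) * C, by positivity, fun q p => ?_⟩
    have h0 : 0 ≤ C * jbr (lam (q 0)) p ^ m :=
      mul_nonneg hC.le (Real.rpow_nonneg (jbr_pos _ _).le _)
    calc lam (q 0) ^ k * ‖c * a q p‖ = ‖c‖ * (lam (q 0) ^ k * ‖a q p‖) := by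
          rw [norm_mul]; ring
      _ ≤ ‖c‖ * (C * jbr (lam (q 0)) p ^ m) := 
          mul_le_mul_of_nonneg_left (h q p) (norm_nonneg c)
      _ ≤ _ := by nlinarith
  induction N generalizing k m a with
  | zero => exact key ha
  | succ N ih =>
    refine ⟨key ha.1, fun i => ⟨?_, ?_⟩⟩
    · convert ih (ha.2 i).1 using 3
      simp only [dq1]
      rw [pdC_mul contDiff_const (ha.smooth.left _), pdC_const, zero_mul, zero_add]
    · convert ih (ha.2 i).2 using 3
      simp only [dp1]
      rw [pdC_mul contDiff_const (ha.smooth.right _), pdC_const, zero_mul, zero_add]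

theorem FiniteSymbol.coord_mul (hpos : ∀ r, 0 < lam r) (hσ : σ ≤ 1) {N : ℕ} {k : ℤ} {m : ℝ}
    (i : Fin n) {a : Vec n → Vec n → ℂ} (ha : FiniteSymbol lam σ N k m a) :
    FiniteSymbol lam σ N (k - angWt i) (m + 1) (fun q p => ((p i : ℝ) : ℂ) * a q p) := by
  have key : ∀ {k m} {a : Vec n → Vec n → ℂ}, WeightedBound lam k m a →
      WeightedBound lam (k - angWt i) (m + 1) (fun q p => ((p i : ℝ) : ℂ) * a q p) := by
    rintro k m a ⟨hs, C, hC, h⟩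
    refine ⟨ContDiff.mul ((contDiff_coord i).comp contDiff_snd) hs, C, hC, fun q p => ?_⟩
    have hl := hpos (q 0)
    calc lam (q 0) ^ (k - angWt i) * ‖((p i : ℝ) : ℂ) * a q p‖
        = (lam (q 0) ^ k * ‖a q p‖) * (lam (q 0) ^ (-angWt i) * |p i|) := by
          rw [norm_mul, sub_eq_add_neg, zpow_add₀ hl.ne', Complex.norm_real, Real.norm_eq_abs]
          ring
      _ ≤ (C * jbr (lam (q 0)) p ^ m) * jbr (lam (q 0)) p :=
          mul_le_mul (h q p) (zpow_angWt_mul_abs_le_jbr hl p i) (by positivity)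
            (mul_nonneg hC.le (Real.rpow_nonneg (jbr_pos _ _).le _))
      _ = _ := by rw [Real.rpow_add (jbr_pos _ _), Real.rpow_one]; ring
  induction N generalizing k m a with
  | zero => exact key ha
  | succ N ih =>
    refine ⟨key ha.1, fun j => ⟨?_, ?_⟩⟩
    · have := ih (ha.2 j).1
      rw [show k - angWt j - angWt i = k - angWt i - angWt j by ring] at this
      convert this using 3
      simp only [dq1]
      rw [pdC_mul contDiff_const (ha.smooth.left _), pdC_const, zero_mul, zero_add]
    · have h1 := ih (ha.2 j).2
      rw [show k + angWt j - angWt i = k - angWt i + angWt j by ring,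
        show m - σ + 1 = m + 1 - σ by ring] at h1
      have h2 : ∀ q p, dp1 j (fun q p => ((p i : ℝ) : ℂ) * a q p) q p =
          (if i = j then 1 else 0) * a q p + ((p i : ℝ) : ℂ) * dp1 j a q p := by
        intro q p
        simp only [dp1]
        rw [pdC_mul (contDiff_coord i) (ha.smooth.right _), pdC_coord]
      rw [show dp1 j (fun q p => ((p i : ℝ) : ℂ) * a q p) = _ from
        funext fun q => funext fun p => h2 q p]
      by_cases hij : i = j
      · subst hij
        have h3 : FiniteSymbol lam σ N (k - angWt i + angWt i) (m + 1 - σ) a := by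
          rw [sub_add_cancel]
          exact ha.of_succ.mono (by linarith)
        simpa using h3.add hpos h1
      · simpa [hij] using h1

/-- A smooth function of `r` all of whose derivatives are bounded. -/
def BoundedDerivs (h : ℝ → ℝ) : Prop :=
  ContDiff ℝ (⊤ : ℕ∞) h ∧ ∀ j : ℕ, ∃ C : ℝ, ∀ r : ℝ, |iteratedDeriv j h r| ≤ C

theorem BoundedDerivs.deriv {h : ℝ → ℝ} (hh : BoundedDerivs h) : BoundedDerivs (deriv h) :=
  ⟨((contDiff_infty_iff_deriv (𝕜 := ℝ)).1 hh.1).2, fun j => by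
    simpa only [← iteratedDeriv_succ'] using hh.2 (j + 1)⟩

theorem contDiff_radial {h : ℝ → ℝ} (hh : ContDiff ℝ (⊤ : ℕ∞) h) :
    ContDiff ℝ (⊤ : ℕ∞) (fun y : Vec n => ((h (y 0) : ℝ) : ℂ)) :=
  Complex.ofRealCLM.contDiff.comp (hh.comp (contDiff_apply ℝ ℝ 0))

theorem pdC_radial {h : ℝ → ℝ} (hh : ContDiff ℝ (⊤ : ℕ∞) h) (i : Fin n) (x : Vec n) :
    pdC i (fun y : Vec n => ((h (y 0) : ℝ) : ℂ)) x =
      if i = 0 then ((deriv h (x 0) : ℝ) : ℂ) else 0 := by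
  have h1 : HasDerivAt h (deriv h (x 0)) (x 0) :=
    (hh.contDiffAt.differentiableAt (by simp)).hasDerivAt
  have h2 : HasFDerivAt (fun y : Vec n => y 0)
      (ContinuousLinearMap.proj (R := ℝ) (φ := fun _ : Fin n => ℝ) 0) x :=
    (ContinuousLinearMap.proj (R := ℝ) (φ := fun _ : Fin n => ℝ) 0).hasFDerivAt
  have h3 : HasFDerivAt (fun y : Vec n => ((h (y 0) : ℝ) : ℂ))
      (Complex.ofRealCLM.comp (deriv h (x 0) •
        ContinuousLinearMap.proj (R := ℝ) (φ := fun _ : Fin n => ℝ) 0)) x :=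
    Complex.ofRealCLM.hasFDerivAt.comp x (h1.comp_hasFDerivAt x h2)
  rw [pdC, h3.fderiv]
  by_cases hi : i = 0
  · subst hi; simp
  · simp [hi, Ne.symm hi]

theorem dq1_radial_mul {h : ℝ → ℝ} (hh : ContDiff ℝ (⊤ : ℕ∞) h) {a : Vec n → Vec n → ℂ}
    (ha : JointSmooth a) (i : Fin n) :
    dq1 i (fun q p => ((h (q 0) : ℝ) : ℂ) * a q p) = fun q p =>
      (if i = 0 then ((deriv h (q 0) : ℝ) : ℂ) else 0) * a q p +
        ((h (q 0) : ℝ) : ℂ) * dq1 i a q p := by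
  funext q p
  simp only [dq1]
  rw [pdC_mul (contDiff_radial hh) (ha.left _), pdC_radial hh]

theorem dp1_radial_mul (h : ℝ → ℝ) {a : Vec n → Vec n → ℂ} (ha : JointSmooth a) (i : Fin n) :
    dp1 i (fun q p => ((h (q 0) : ℝ) : ℂ) * a q p) = fun q p =>
      ((h (q 0) : ℝ) : ℂ) * dp1 i a q p := by
  funext q p
  simp only [dp1]
  rw [pdC_mul contDiff_const (ha.right _), pdC_const, zero_mul, zero_add]

theorem FiniteSymbol.radial_mul (hpos : ∀ r, 0 < lam r) {h : ℝ → ℝ} (hh : BoundedDerivs h)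
    {N : ℕ} {k : ℤ} {m : ℝ} {a : Vec n → Vec n → ℂ} (ha : FiniteSymbol lam σ N k m a) :
    FiniteSymbol lam σ N k m (fun q p => ((h (q 0) : ℝ) : ℂ) * a q p) := by
  have key : ∀ {h k m} {a : Vec n → Vec n → ℂ}, BoundedDerivs h → WeightedBound lam k m a →
      WeightedBound lam k m (fun q p => ((h (q 0) : ℝ) : ℂ) * a q p) := by
    rintro h k m a hh ⟨hs, C, hC, hb⟩
    obtain ⟨M, hM⟩ := hh.2 0
    simp only [iteratedDeriv_zero] at hM
    have hM0 : 0 ≤ M := (abs_nonneg _).trans (hM 0)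
    refine ⟨ContDiff.mul ((contDiff_radial hh.1).comp contDiff_fst) hs, (M + 1) * C,
      by positivity, fun q p => ?_⟩
    have h0 : 0 ≤ C * jbr (lam (q 0)) p ^ m :=
      mul_nonneg hC.le (Real.rpow_nonneg (jbr_pos _ _).le _)
    have hl := zpow_pos (hpos (q 0)) k
    calc lam (q 0) ^ k * ‖((h (q 0) : ℝ) : ℂ) * a q p‖
        = |h (q 0)| * (lam (q 0) ^ k * ‖a q p‖) := by
          rw [norm_mul, Complex.norm_real, Real.norm_eq_abs]; ring
      _ ≤ M * (C * jbr (lam (q 0)) p ^ m) := 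
          mul_le_mul (hM _) (hb q p) (by positivity) hM0
      _ ≤ _ := by nlinarith
  induction N generalizing h k m a with
  | zero => exact key hh ha
  | succ N ih =>
    refine ⟨key hh ha.1, fun i => ⟨?_, ?_⟩⟩
    · rw [dq1_radial_mul hh.1 ha.smooth]
      have h1 := ih hh (ha.2 i).1
      by_cases hi : i = 0
      · have h2 : FiniteSymbol lam σ N (k - angWt i) m a := by
          simpa [angWt, hi] using ha.of_succ
        simpa [hi] using (ih hh.deriv h2).add hpos h1
      · simpa [hi] using h1
    · rw [dp1_radial_mul h ha.smooth]
      exact ih hh (ha.2 i).2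

theorem LogDerBounded.boundedDerivs_deriv_log (hlam : LogDerBounded lam) :
    BoundedDerivs (deriv (fun s => Real.log (lam s))) :=
  ⟨((contDiff_infty_iff_deriv (𝕜 := ℝ)).1 (hlam.2.1.log fun r => (hlam.1 r).ne')).2, fun j => by
    simpa only [← iteratedDeriv_succ'] using hlam.2.2 j⟩

theorem LogDerBounded.contDiff_inv (hlam : LogDerBounded lam) :
    ContDiff ℝ (⊤ : ℕ∞) (fun r => (lam r)⁻¹) :=
  hlam.2.1.inv fun r => (hlam.1 r).ne'

theorem LogDerBounded.deriv_inv (hlam : LogDerBounded lam) (r : ℝ) :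
    deriv (fun s => (lam s)⁻¹) r = -((lam r)⁻¹ * deriv (fun s => Real.log (lam s)) r) := by
  have h : HasDerivAt lam (deriv lam r) r :=
    (hlam.2.1.contDiffAt.differentiableAt (by simp)).hasDerivAt
  have h0 := (hlam.1 r).ne'
  rw [(h.fun_inv h0).deriv, (h.log h0).deriv]
  field_simp

theorem FiniteSymbol.inv_weight_mul (hlam : LogDerBounded lam) {N : ℕ} {k : ℤ} {m : ℝ}
    {a : Vec n → Vec n → ℂ} (ha : FiniteSymbol lam σ N k m a) :
    FiniteSymbol lam σ N (k + 1) m (fun q p => (((lam (q 0))⁻¹ : ℝ) : ℂ) * a q p) := by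
  have key : ∀ {k m} {a : Vec n → Vec n → ℂ}, WeightedBound lam k m a →
      WeightedBound lam (k + 1) m (fun q p => (((lam (q 0))⁻¹ : ℝ) : ℂ) * a q p) := by
    rintro k m a ⟨hs, C, hC, hb⟩
    refine ⟨ContDiff.mul ((contDiff_radial hlam.contDiff_inv).comp contDiff_fst) hs, C, hC,
      fun q p => le_trans (le_of_eq ?_) (hb q p)⟩
    have hl := hlam.1 (q 0)
    rw [norm_mul, Complex.norm_real, Real.norm_eq_abs, abs_of_pos (inv_pos.2 hl),
      zpow_add_one₀ hl.ne']
    field_simp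
  induction N generalizing k m a with
  | zero => exact key ha
  | succ N ih =>
    refine ⟨key ha.1, fun i => ⟨?_, ?_⟩⟩
    · rw [dq1_radial_mul hlam.contDiff_inv ha.smooth]
      have h1 := ih (ha.2 i).1
      by_cases hi : i = 0
      · simp only [hi, angWt, if_true, sub_zero] at h1 ⊢
        have h2 := (ih (ha.of_succ.radial_mul hlam.1 hlam.boundedDerivs_deriv_log)).const_mul (-1)
        convert h2.add hlam.1 h1 using 3
        rw [hlam.deriv_inv]
        push_cast
        ring
      · rw [show k + 1 - angWt i = k - angWt i + 1 by ring]
        simpa [hi] using h1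
    · rw [dp1_radial_mul (fun r => (lam r)⁻¹) ha.smooth,
        show k + 1 + angWt i = k + angWt i + 1 by ring]
      exact ih (ha.2 i).2

end SymbolCalculus
section SymbolClass

variable {n : ℕ} [NeZero n] {lam : ℝ → ℝ} {σ : ℝ}

theorem FiniteSymbol.dq1 {k : ℤ} {m : ℝ} {a : Vec n → Vec n → ℂ}
    (ha : ∀ N, FiniteSymbol lam σ N k m a) (i : Fin n) (N : ℕ) :
    FiniteSymbol lam σ N (k - angWt i) m (dq1 i a) :=
  ((ha (N + 1)).2 i).1

theorem FiniteSymbol.dp1 {k : ℤ} {m : ℝ} {a : Vec n → Vec n → ℂ}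
    (ha : ∀ N, FiniteSymbol lam σ N k m a) (i : Fin n) (N : ℕ) :
    FiniteSymbol lam σ N (k + angWt i) (m - σ) (dp1 i a) :=
  ((ha (N + 1)).2 i).2

theorem FiniteSymbol.dqS {k : ℤ} {m : ℝ} {a : Vec n → Vec n → ℂ}
    (ha : ∀ N, FiniteSymbol lam σ N k m a) (A : Fin n → ℕ) (N : ℕ) :
    FiniteSymbol lam σ N (k - angLen A) m (dqS A a) := by
  have hit : ∀ (i : Fin n) (c : ℕ) {k : ℤ} {a : Vec n → Vec n → ℂ},
      (∀ N, FiniteSymbol lam σ N k m a) →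
      ∀ N, FiniteSymbol lam σ N (k - c * angWt i) m ((_root_.dq1 i)^[c] a) := by
    intro i c
    induction c with
    | zero => intro k a ha; simpa using ha
    | succ c ih =>
      intro k a ha N
      rw [Function.iterate_succ_apply]
      convert ih (FiniteSymbol.dq1 ha i) N using 1
      push_cast
      ring
  have hl : ∀ (l : List (Fin n)) (N : ℕ), FiniteSymbol lam σ N
      (k - (l.map fun i => A i * angWt i).sum) m
      (l.foldr (fun i g => (_root_.dq1 i)^[A i] g) a) := by
    intro l
    induction l with
    | nil => simpa using ha
    | cons i l ih =>
      intro N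
      rw [List.foldr_cons]
      convert hit i (A i) ih N using 1
      simp only [List.map_cons, List.sum_cons]
      ring
  rw [dqS_eq_foldr, angLen_eq_sum, Fin.sum_univ_def]
  exact hl _ N

theorem FiniteSymbol.dpS {k : ℤ} {m : ℝ} {a : Vec n → Vec n → ℂ}
    (ha : ∀ N, FiniteSymbol lam σ N k m a) (B : Fin n → ℕ) (N : ℕ) :
    FiniteSymbol lam σ N (k + angLen B) (m - σ * fullLen B) (dpS B a) := by
  have hit : ∀ (i : Fin n) (c : ℕ) {k : ℤ} {m : ℝ} {a : Vec n → Vec n → ℂ},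
      (∀ N, FiniteSymbol lam σ N k m a) →
      ∀ N, FiniteSymbol lam σ N (k + c * angWt i) (m - σ * c) ((_root_.dp1 i)^[c] a) := by
    intro i c
    induction c with
    | zero => intro k m a ha; simpa using ha
    | succ c ih =>
      intro k m a ha N
      rw [Function.iterate_succ_apply]
      convert ih (FiniteSymbol.dp1 ha i) N using 1 <;> push_cast <;> ring
  have hl : ∀ (l : List (Fin n)) (N : ℕ), FiniteSymbol lam σ N
      (k + (l.map fun i => B i * angWt i).sum) (m - σ * ((l.map B).sum : ℕ))
      (l.foldr (fun i g => (_root_.dp1 i)^[B i] g) a) := by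
    intro l
    induction l with
    | nil => simpa using ha
    | cons i l ih =>
      intro N
      rw [List.foldr_cons]
      convert hit i (B i) ih N using 1 <;> simp only [List.map_cons, List.sum_cons] <;>
        push_cast <;> ring
  rw [dpS_eq_foldr, angLen_eq_sum, fullLen, Fin.sum_univ_def, Fin.sum_univ_def]
  exact hl _ N

/-- `λ(r)^k a ∈ S^m_σ(λ)`, expressed through multiindices. -/
def MultiindexSymbol (lam : ℝ → ℝ) (σ : ℝ) (k : ℤ) (m : ℝ) (a : Vec n → Vec n → ℂ) : Prop :=
  JointSmooth a ∧ ∀ A B : Fin n → ℕ, ∃ C > 0, ∀ q p : Vec n,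
    lam (q 0) ^ ((angLen B : ℤ) - (angLen A : ℤ) + k) * ‖dqS A (dpS B a) q p‖
      ≤ C * jbr (lam (q 0)) p ^ (m - σ * (fullLen B : ℝ))

theorem MultiindexSymbol.dq1 {k : ℤ} {m : ℝ} {a : Vec n → Vec n → ℂ}
    (ha : MultiindexSymbol lam σ k m a) (i : Fin n) :
    MultiindexSymbol lam σ (k - angWt i) m (dq1 i a) := by
  refine ⟨ha.1.dq1 i, fun A B => ?_⟩
  obtain ⟨C, hC, h⟩ := ha.2 (A + Pi.single i 1) B
  refine ⟨C, hC, fun q p => ?_⟩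
  rw [dpS_dq1 ha.1, dqS_dq1 (ha.1.dpS B)]
  convert h q p using 3
  rw [angLen_add_single]
  ring

theorem MultiindexSymbol.dp1 {k : ℤ} {m : ℝ} {a : Vec n → Vec n → ℂ}
    (ha : MultiindexSymbol lam σ k m a) (i : Fin n) :
    MultiindexSymbol lam σ (k + angWt i) (m - σ) (dp1 i a) := by
  refine ⟨ha.1.dp1 i, fun A B => ?_⟩
  obtain ⟨C, hC, h⟩ := ha.2 A (B + Pi.single i 1)
  refine ⟨C, hC, fun q p => ?_⟩
  rw [dpS_dp1 ha.1]
  convert h q p using 3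
  · rw [angLen_add_single]
    ring
  · rw [fullLen_add_single]
    push_cast
    ring

theorem MultiindexSymbol.finiteSymbol {k : ℤ} {m : ℝ} {a : Vec n → Vec n → ℂ}
    (ha : MultiindexSymbol lam σ k m a) (N : ℕ) : FiniteSymbol lam σ N k m a := by
  have key : ∀ {k m} {a : Vec n → Vec n → ℂ}, MultiindexSymbol lam σ k m a →
      WeightedBound lam k m a := by
    rintro k m a ⟨hs, h⟩
    obtain ⟨C, hC, h⟩ := h 0 0
    refine ⟨hs, C, hC, fun q p => ?_⟩
    simpa [dqS_zero, dpS_zero, angLen, fullLen] using h q p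
  induction N generalizing k m a with
  | zero => exact key ha
  | succ N ih => exact ⟨key ha, fun i => ⟨ih (ha.dq1 i), ih (ha.dp1 i)⟩⟩

theorem isSymbol_iff_forall_finiteSymbol {m : ℝ} {a : Vec n → Vec n → ℂ} :
    IsSymbol lam m σ a ↔ ∀ N, FiniteSymbol lam σ N 0 m a := by
  constructor
  · intro h
    exact MultiindexSymbol.finiteSymbol (by simpa [MultiindexSymbol, IsSymbol, JointSmooth] using h)
  · intro h
    refine ⟨(h 0).smooth, fun A B => ?_⟩
    obtain ⟨C, hC, hb⟩ := (FiniteSymbol.dqS (FiniteSymbol.dpS h B) A 0).weightedBound.2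
    exact ⟨C, hC, fun q p => by simpa using hb q p⟩

theorem IsSymbol.smooth {m : ℝ} {a : Vec n → Vec n → ℂ} (h : IsSymbol lam m σ a) :
    JointSmooth a := h.1

/-- The operator `p_i + D_{q_i}` acting on symbols. -/
noncomputable def opShift (i : Fin n) (b : Vec n → Vec n → ℂ) : Vec n → Vec n → ℂ :=
  fun q p => ((p i : ℝ) : ℂ) * b q p + Complex.I⁻¹ * dq1 i b q p

theorem opRho_eq {b : Vec n → Vec n → ℂ} (hb : JointSmooth b) : opRho b = opShift 0 b := by
  unfold opRho opShift
  rw [dqS_single hb]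

theorem opEta_eq {b : Vec n → Vec n → ℂ} (hb : JointSmooth b) (i : Fin n) :
    opEta lam i b = fun q p => (((lam (q 0))⁻¹ : ℝ) : ℂ) * opShift i b q p := by
  unfold opEta opShift
  rw [dqS_single hb]
  funext q p
  push_cast
  ring

theorem FiniteSymbol.opShift (hpos : ∀ r, 0 < lam r) (hσ : σ ≤ 1) {k : ℤ} {m : ℝ}
    {b : Vec n → Vec n → ℂ} (hb : ∀ N, FiniteSymbol lam σ N k m b) (i : Fin n) (N : ℕ) :
    FiniteSymbol lam σ N (k - angWt i) (m + 1) (opShift i b) :=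
  ((hb N).coord_mul hpos hσ i).add hpos
    (((FiniteSymbol.dq1 hb i N).const_mul _).mono (by linarith))

theorem IsSymbol.opRho (hpos : ∀ r, 0 < lam r) (hσ : σ ≤ 1) {m : ℝ} {b : Vec n → Vec n → ℂ}
    (hb : IsSymbol lam m σ b) : IsSymbol lam (m + 1) σ (opRho b) := by
  rw [opRho_eq hb.smooth]
  rw [isSymbol_iff_forall_finiteSymbol] at hb ⊢
  intro N
  simpa [angWt] using FiniteSymbol.opShift hpos hσ hb 0 N

theorem IsSymbol.opEta (hlam : LogDerBounded lam) (hσ : σ ≤ 1) {m : ℝ} {b : Vec n → Vec n → ℂ}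
    (hb : IsSymbol lam m σ b) {i : Fin n} (hi : i ≠ 0) :
    IsSymbol lam (m + 1) σ (opEta lam i b) := by
  rw [opEta_eq hb.smooth]
  rw [isSymbol_iff_forall_finiteSymbol] at hb ⊢
  intro N
  simpa [angWt, hi] using (FiniteSymbol.opShift hlam.1 hσ hb i N).inv_weight_mul hlam

theorem IsSymbol.opRho_iterate (hpos : ∀ r, 0 < lam r) (hσ : σ ≤ 1) {m : ℝ}
    {b : Vec n → Vec n → ℂ} (hb : IsSymbol lam m σ b) (c : ℕ) :
    IsSymbol lam (m + c) σ (_root_.opRho^[c] b) := by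
  induction c with
  | zero => simpa using hb
  | succ c ih =>
    rw [Function.iterate_succ_apply']
    convert ih.opRho hpos hσ using 1
    push_cast
    ring

theorem IsSymbol.opEta_iterate (hlam : LogDerBounded lam) (hσ : σ ≤ 1) {m : ℝ}
    {b : Vec n → Vec n → ℂ} (hb : IsSymbol lam m σ b) {i : Fin n} (hi : i ≠ 0) (c : ℕ) :
    IsSymbol lam (m + c) σ ((_root_.opEta lam i)^[c] b) := by
  induction c with
  | zero => simpa using hb
  | succ c ih =>
    rw [Function.iterate_succ_apply']
    convert ih.opEta hlam hσ hi using 1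
    push_cast
    ring

theorem IsSymbol.foldr_opEta (hlam : LogDerBounded lam) (hσ : σ ≤ 1) {m : ℝ}
    {b : Vec n → Vec n → ℂ} (hb : IsSymbol lam m σ b) (Γ : Fin n → ℕ) (l : List (Fin n)) :
    IsSymbol lam (m + ((l.map fun i => if i = 0 then 0 else Γ i).sum : ℕ)) σ
      (l.foldr (fun i g => if i = 0 then g else (_root_.opEta lam i)^[Γ i] g) b) := by
  induction l with
  | nil => simpa using hb
  | cons i l ih =>
    rw [List.foldr_cons, List.map_cons, List.sum_cons]
    by_cases hi : i = 0
    · simpa [hi] using ih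
    · simp only [hi, if_false]
      convert ih.opEta_iterate hlam hσ hi (Γ i) using 1
      push_cast
      ring

theorem angLen_eq_list_sum (Γ : Fin n → ℕ) :
    angLen Γ = ((List.finRange n).map fun i => if i = 0 then 0 else Γ i).sum := by
  rw [angLen, Fin.sum_univ_def]

theorem fullLen_eq (Γ : Fin n → ℕ) : fullLen Γ = Γ 0 + angLen Γ := by
  rw [fullLen, angLen, ← Finset.add_sum_erase _ _ (Finset.mem_univ (0 : Fin n)),
    ← Finset.add_sum_erase _ (fun i => if i = 0 then 0 else Γ i) (Finset.mem_univ (0 : Fin n))]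
  simp only [if_true, zero_add]
  congr 1
  exact Finset.sum_congr rfl fun i hi => by rw [if_neg (Finset.ne_of_mem_erase hi)]

theorem IsSymbol.compSym (hlam : LogDerBounded lam) (hσ : σ ≤ 1) {m : ℝ}
    {b : Vec n → Vec n → ℂ} (hb : IsSymbol lam m σ b) (Γ : Fin n → ℕ) :
    IsSymbol lam (m + (fullLen Γ : ℝ)) σ (compSym lam Γ b) := by
  have h := (hb.opRho_iterate hlam.1 hσ (Γ 0)).foldr_opEta hlam hσ Γ (List.finRange n)
  rw [← angLen_eq_list_sum, add_assoc, ← Nat.cast_add, ← fullLen_eq] at h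
  exact h

end SymbolClass
section Oscillatory

variable {n : ℕ}

theorem contDiff_phase :
    ContDiff ℝ (⊤ : ℕ∞) (fun x : Vec n × Vec n × Vec n => phase x.1 x.2.1 x.2.2) := by
  unfold phase
  refine (contDiff_const.mul (Complex.ofRealCLM.contDiff.comp
    (g := fun y : ℝ => (y : ℂ)) ?_)).cexp
  fun_prop

theorem norm_phase (p q q' : Vec n) : ‖phase p q q'‖ = 1 := by
  rw [phase, mul_comm, Complex.norm_exp_ofReal_mul_I]

theorem phase_eq_mul (p q q' : Vec n) : phase p q q' = phase p q 0 * phase p 0 q' := by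
  simp only [phase, ← Complex.exp_add, ← mul_add, ← Complex.ofReal_add,
    ← Finset.sum_add_distrib]
  congr 4
  funext i
  simp only [Pi.zero_apply, sub_zero, zero_sub]
  ring

theorem phase_neg (p q : Vec n) : phase p 0 q = phase (-p) q 0 := by
  simp [phase]

theorem pdC_phase (p q : Vec n) (i : Fin n) :
    pdC i (fun x => phase p x 0) q = Complex.I * p i * phase p q 0 := by
  have h1 : HasFDerivAt (fun x : Vec n => ∑ j, p j * (x j - (0 : Vec n) j))
      (∑ j, p j • ContinuousLinearMap.proj (R := ℝ) (φ := fun _ : Fin n => ℝ) j) q :=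
    HasFDerivAt.fun_sum fun j _ =>
      (((ContinuousLinearMap.proj (R := ℝ) (φ := fun _ : Fin n => ℝ) j).hasFDerivAt).sub_const
        _).const_mul (p j)
  have h2 := ((Complex.ofRealCLM.hasFDerivAt.comp q h1).const_mul Complex.I).cexp
  have h3 : HasFDerivAt (fun x => phase p x 0) _ q := h2
  rw [pdC, h3.fderiv]
  simp [phase, Pi.single_apply]
  ring

/-- The oscillatory integral `∫ e^{-ip·q'} u(q') dq'`. -/
noncomputable def oscInt (u : Vec n → ℂ) (p : Vec n) : ℂ := ∫ q', phase p 0 q' * u q'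

theorem norm_oscInt_le (u : Vec n → ℂ) (p : Vec n) : ‖oscInt u p‖ ≤ ∫ q', ‖u q'‖ := by
  refine (norm_integral_le_integral_norm _).trans (le_of_eq ?_)
  simp only [norm_mul, norm_phase, one_mul]

theorem continuous_phase_left (q q' : Vec n) : Continuous fun p => phase p q q' :=
  contDiff_phase.continuous.comp (by fun_prop : Continuous fun p : Vec n => (p, q, q'))

theorem contDiff_phase_right (p q : Vec n) :
    ContDiff ℝ (⊤ : ℕ∞) fun q' => phase p q q' :=
  contDiff_phase.comp (by fun_prop : ContDiff ℝ (⊤ : ℕ∞) fun q' : Vec n => (p, q, q'))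

theorem contDiff_phase_mid (p q' : Vec n) : ContDiff ℝ (⊤ : ℕ∞) fun q => phase p q q' :=
  contDiff_phase.comp (by fun_prop : ContDiff ℝ (⊤ : ℕ∞) fun q : Vec n => (p, q, q'))

theorem jointSmooth_phase : JointSmooth fun q p : Vec n => phase p q 0 :=
  contDiff_phase.comp
    (by fun_prop : ContDiff ℝ (⊤ : ℕ∞) fun x : Vec n × Vec n => (x.2, x.1, (0 : Vec n)))

theorem continuous_oscInt {u : Vec n → ℂ} (hu : Continuous u) (hc : HasCompactSupport u) :
    Continuous (oscInt u) := by
  refine continuous_of_dominated (bound := fun q' => ‖u q'‖) (fun p => ?_) (fun p => ?_)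
    (hu.integrable_of_hasCompactSupport hc).norm ?_
  · exact ((contDiff_phase_right p 0).continuous.mul hu).aestronglyMeasurable
  · exact Filter.Eventually.of_forall fun q' => by rw [norm_mul, norm_phase, one_mul]
  · exact Filter.Eventually.of_forall fun q' =>
      (continuous_phase_left 0 q').mul continuous_const

theorem contDiff_pdC {u : Vec n → ℂ} (hu : ContDiff ℝ (⊤ : ℕ∞) u) (i : Fin n) :
    ContDiff ℝ (⊤ : ℕ∞) (pdC i u) :=
  contDiff_fderiv_apply_const hu _

theorem hasCompactSupport_pdC {u : Vec n → ℂ} (hc : HasCompactSupport u) (i : Fin n) :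
    HasCompactSupport (pdC i u) :=
  hc.fderiv_apply ℝ _

theorem oscInt_pdC {u : Vec n → ℂ} (hu : ContDiff ℝ (⊤ : ℕ∞) u) (hc : HasCompactSupport u)
    (i : Fin n) (p : Vec n) : oscInt (pdC i u) p = Complex.I * p i * oscInt u p := by
  have hph := contDiff_phase_right p 0
  have hd : ∀ q', fderiv ℝ (fun x => phase p 0 x) q' (Pi.single i 1) =
      -(Complex.I * p i) * phase p 0 q' := by
    intro q'
    have := pdC_phase (-p) q' i
    simp only [← phase_neg] at this
    simpa [pdC] using this
  have h := integral_mul_fderiv_eq_neg_fderiv_mul_of_integrable (μ := volume)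
    (f := fun x => phase p 0 x) (g := u) (v := Pi.single i 1)
    (((contDiff_fderiv_apply_const hph _).continuous.mul
      hu.continuous).integrable_of_hasCompactSupport hc.mul_left)
    ((hph.continuous.mul (contDiff_pdC hu i).continuous).integrable_of_hasCompactSupport
      (hasCompactSupport_pdC hc i).mul_left)
    ((hph.continuous.mul hu.continuous).integrable_of_hasCompactSupport hc.mul_left)
    (fun x _ => hph.contDiffAt.differentiableAt (by simp))
    (fun x _ => hu.contDiffAt.differentiableAt (by simp))
  unfold oscInt
  refine h.trans ?_
  simp only [hd]
  rw [← integral_neg, ← integral_const_mul]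
  congr 1
  funext q'
  ring

theorem norm_le_sum_abs (p : Vec n) : ‖p‖ ≤ ∑ i, |p i| :=
  (pi_norm_le_iff_of_nonneg (Finset.sum_nonneg fun _ _ => abs_nonneg _)).2 fun i =>
    Finset.single_le_sum (f := fun i => |p i|) (fun _ _ => abs_nonneg _) (Finset.mem_univ i)

theorem exists_oscInt_decay (N : ℕ) {u : Vec n → ℂ} (hu : ContDiff ℝ (⊤ : ℕ∞) u)
    (hc : HasCompactSupport u) : ∃ C : ℝ, ∀ p, (1 + ‖p‖) ^ N * ‖oscInt u p‖ ≤ C := by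
  induction N generalizing u with
  | zero => exact ⟨_, fun p => by simpa using norm_oscInt_le u p⟩
  | succ N ih =>
    obtain ⟨C, hC⟩ := ih hu hc
    choose K hK using fun i => ih (contDiff_pdC hu i) (hasCompactSupport_pdC hc i)
    refine ⟨C + ∑ i, K i, fun p => ?_⟩
    calc (1 + ‖p‖) ^ (N + 1) * ‖oscInt u p‖
        = (1 + ‖p‖) ^ N * ((1 + ‖p‖) * ‖oscInt u p‖) := by ring
      _ ≤ (1 + ‖p‖) ^ N * ((1 + ∑ i, |p i|) * ‖oscInt u p‖) := by
          gcongr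
          exact norm_le_sum_abs p
      _ = (1 + ‖p‖) ^ N * ‖oscInt u p‖ + ∑ i, (1 + ‖p‖) ^ N * ‖oscInt (pdC i u) p‖ := by
          simp only [oscInt_pdC hu hc, norm_mul, Complex.norm_I, Complex.norm_real,
            Real.norm_eq_abs, one_mul, ← Finset.mul_sum, ← Finset.sum_mul]
          ring
      _ ≤ C + ∑ i, K i := add_le_add (hC p) (Finset.sum_le_sum fun i _ => hK i p)

theorem integrable_pow_mul_oscInt (N : ℕ) {u : Vec n → ℂ} (hu : ContDiff ℝ (⊤ : ℕ∞) u)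
    (hc : HasCompactSupport u) :
    Integrable fun p : Vec n => (1 + ‖p‖) ^ N * ‖oscInt u p‖ := by
  obtain ⟨C, hC⟩ := exists_oscInt_decay (N + (n + 1)) hu hc
  have hint : Integrable fun p : Vec n => (1 + ‖p‖) ^ (-((n + 1 : ℕ) : ℝ)) :=
    integrable_one_add_norm (by simp)
  refine (hint.const_mul C).mono' ?_ (Filter.Eventually.of_forall fun p => ?_)
  · have := continuous_oscInt hu.continuous hc
    exact Continuous.aestronglyMeasurable (by fun_prop)
  · have h0 : 0 < 1 + ‖p‖ := by positivity
    rw [Real.norm_of_nonneg (by positivity), Real.rpow_neg h0.le, Real.rpow_natCast,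
      ← div_eq_mul_inv, le_div_iff₀ (by positivity)]
    refine le_trans (le_of_eq ?_) (hC p)
    rw [pow_add]
    ring

end Oscillatory

section LocalBounds

variable {n : ℕ} [NeZero n] {lam : ℝ → ℝ}

theorem jbr_le_mul_one_add_norm {μ D : ℝ} (hμ : |μ⁻¹| ≤ D) (p : Vec n) :
    jbr μ p ≤ ((1 + n) * (1 + D)) * (1 + ‖p‖) := by
  have hD : 0 ≤ D := (abs_nonneg _).trans hμ
  have hp := norm_nonneg p
  rw [jbr, Real.sqrt_le_iff]
  refine ⟨by positivity, ?_⟩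
  have h : ∀ i : Fin n, (if i = 0 then p i else μ⁻¹ * p i) ^ 2 ≤ ((1 + D) * ‖p‖) ^ 2 := by
    intro i
    have hi : |p i| ≤ ‖p‖ := norm_le_pi_norm p i
    refine sq_le_sq' ?_ ?_ <;> [apply neg_le_of_abs_le; apply le_of_abs_le]
    all_goals
      split_ifs
      · nlinarith
      · rw [abs_mul]
        nlinarith [mul_le_mul hμ hi (abs_nonneg _) hD]
  have hs := Finset.sum_le_sum fun i (_ : i ∈ Finset.univ) => h i
  rw [Finset.sum_const, Finset.card_univ, Fintype.card_fin, nsmul_eq_mul] at hs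
  have hn : (0 : ℝ) ≤ n := Nat.cast_nonneg n
  have h1 : 0 ≤ (1 + D) * ‖p‖ := by positivity
  have h2 : 1 ≤ 1 + D := by linarith
  have h3 : ((1 + n) * (1 + D)) * (1 + ‖p‖) = (1 + n) * ((1 + D) + (1 + D) * ‖p‖) := by ring
  rw [h3, mul_pow]
  have h4 : 1 + ((1 + D) * ‖p‖) ^ 2 ≤ ((1 + D) + (1 + D) * ‖p‖) ^ 2 := by nlinarith
  have h5 : (1 + n : ℝ) ≤ (1 + n) ^ 2 := by nlinarith
  calc 1 + ∑ i, (if i = 0 then p i else μ⁻¹ * p i) ^ 2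
      ≤ (1 + n) * (1 + ((1 + D) * ‖p‖) ^ 2) := by nlinarith [sq_nonneg ((1 + D) * ‖p‖)]
    _ ≤ _ := by gcongr

theorem WeightedBound.exists_local_bound (hpos : ∀ r, 0 < lam r) (hcont : Continuous lam)
    {k : ℤ} {m : ℝ} {a : Vec n → Vec n → ℂ} (ha : WeightedBound lam k m a) (q₀ : Vec n) :
    ∃ (C : ℝ) (N : ℕ), ∀ q ∈ Metric.ball q₀ 1, ∀ p, ‖a q p‖ ≤ C * (1 + ‖p‖) ^ N := by
  obtain ⟨-, C, hC, h⟩ := ha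
  have hK : IsCompact (Metric.closedBall (q₀ 0) 1) := isCompact_closedBall _ _
  obtain ⟨K, hK1⟩ := hK.exists_bound_of_continuousOn
    (hcont.zpow₀ (-k) fun r => Or.inl (hpos r).ne').continuousOn
  obtain ⟨D, hD⟩ := hK.exists_bound_of_continuousOn
    (hcont.inv₀ fun r => (hpos r).ne').continuousOn
  set N := ⌈|m|⌉₊
  refine ⟨K * (C * ((1 + n) * (1 + D)) ^ N), N, fun q hq p => ?_⟩
  have hq0 : q 0 ∈ Metric.closedBall (q₀ 0) 1 :=
    Metric.mem_closedBall.2 ((dist_le_pi_dist q q₀ 0).trans (Metric.mem_ball.1 hq).le)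
  have hl := hpos (q 0)
  have hk := hK1 _ hq0
  rw [Real.norm_of_nonneg (by positivity)] at hk
  have hj0 : 0 < jbr (lam (q 0)) p := jbr_pos _ _
  have hj : jbr (lam (q 0)) p ^ m ≤ (((1 + n) * (1 + D)) * (1 + ‖p‖)) ^ N := by
    calc jbr (lam (q 0)) p ^ m ≤ jbr (lam (q 0)) p ^ (N : ℝ) :=
          Real.rpow_le_rpow_of_exponent_le (one_le_jbr _ _)
            ((le_abs_self m).trans (Nat.le_ceil _))
      _ = jbr (lam (q 0)) p ^ N := Real.rpow_natCast _ _
      _ ≤ _ := by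
          gcongr
          exact jbr_le_mul_one_add_norm (hD _ hq0) p
  have hK0 : 0 ≤ K := (zpow_pos hl (-k)).le.trans hk
  calc ‖a q p‖ = lam (q 0) ^ (-k) * (lam (q 0) ^ k * ‖a q p‖) := by
        rw [← mul_assoc, ← zpow_add₀ hl.ne', neg_add_cancel, zpow_zero, one_mul]
    _ ≤ K * (C * (((1 + n) * (1 + D)) * (1 + ‖p‖)) ^ N) := by
        have h0 : 0 ≤ lam (q 0) ^ k * ‖a q p‖ := by positivity
        exact mul_le_mul hk ((h q p).trans (mul_le_mul_of_nonneg_left hj hC.le)) h0 hK0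
    _ = _ := by rw [mul_pow]; ring

end LocalBounds
section Differentiation

variable {n : ℕ} [NeZero n] {lam : ℝ → ℝ} {σ : ℝ}

omit [NeZero n] in
theorem OpSym_eq_integral (b : Vec n → Vec n → ℂ) (u : Vec n → ℂ) (q : Vec n) :
    OpSym b u q = (((2 * Real.pi) ^ (-(n : ℤ)) : ℝ) : ℂ) *
      ∫ p : Vec n, b q p * phase p q 0 * oscInt u p := by
  unfold OpSym Op oscInt
  congr 1
  congr 1
  funext p
  rw [← integral_const_mul]
  congr 1
  funext q'
  rw [phase_eq_mul p q q']
  ring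

theorem OpSym_radial_mul (h : ℝ → ℝ) (b : Vec n → Vec n → ℂ) (u : Vec n → ℂ) (q : Vec n) :
    OpSym (fun q p => ((h (q 0) : ℝ) : ℂ) * b q p) u q = ((h (q 0) : ℝ) : ℂ) * OpSym b u q := by
  simp only [OpSym_eq_integral]
  rw [mul_left_comm ((h (q 0) : ℝ) : ℂ)]
  congr 1
  rw [← integral_const_mul]
  simp only [mul_assoc]

omit [NeZero n] in
theorem norm_clm_le_sum (L : Vec n →L[ℝ] ℂ) : ‖L‖ ≤ ∑ i, ‖L (Pi.single i 1)‖ := by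
  refine L.opNorm_le_bound (Finset.sum_nonneg fun _ _ => norm_nonneg _) fun v => ?_
  have hv : L v = ∑ i, v i • L (Pi.single i 1) := by
    conv_lhs => rw [pi_eq_sum_univ' v]
    simp
  rw [hv, Finset.sum_mul]
  refine (norm_sum_le _ _).trans (Finset.sum_le_sum fun i _ => ?_)
  rw [norm_smul, mul_comm]
  gcongr
  exact norm_le_pi_norm v i

omit [NeZero n] in
theorem pdC_integrand {b : Vec n → Vec n → ℂ} (hb : JointSmooth b) (z : ℂ) (p q : Vec n)
    (i : Fin n) :
    pdC i (fun x => b x p * phase p x 0 * z) q =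
      Complex.I * (opShift i b q p * phase p q 0 * z) := by
  rw [pdC_mul ((hb.left p).mul (contDiff_phase_mid p 0)) contDiff_const,
    pdC_mul (hb.left p) (contDiff_phase_mid p 0), pdC_const, pdC_phase]
  have h : Complex.I * Complex.I⁻¹ = 1 := mul_inv_cancel₀ Complex.I_ne_zero
  simp only [opShift, dq1]
  linear_combination (-pdC i (fun x => b x p) q * phase p q 0 * z) * h

theorem differentiable_OpSym (hpos : ∀ r, 0 < lam r) (hcont : Continuous lam) (hσ : σ ≤ 1)
    {k : ℤ} {m : ℝ} {b : Vec n → Vec n → ℂ} (hb : ∀ N, FiniteSymbol lam σ N k m b)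
    {u : Vec n → ℂ} (hu : ContDiff ℝ (⊤ : ℕ∞) u) (hc : HasCompactSupport u) :
    Differentiable ℝ (OpSym b u) ∧
      ∀ i q, pdC i (OpSym b u) q = Complex.I * OpSym (opShift i b) u q := by
  have hs := (hb 0).smooth
  have hosc := continuous_oscInt hu.continuous hc
  set F : Vec n → Vec n → ℂ := fun q p => b q p * phase p q 0 * oscInt u p with hF
  have hbph : JointSmooth fun q p => b q p * phase p q 0 := hs.mul jointSmooth_phase
  have hFs : ∀ p, ContDiff ℝ (⊤ : ℕ∞) fun q => F q p := fun p =>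
    (hbph.left p).mul contDiff_const
  have hFd : ∀ p q, HasFDerivAt (fun x => F x p) (fderiv ℝ (fun x => F x p) q) q := fun p q =>
    ((hFs p).contDiffAt.differentiableAt (by simp)).hasFDerivAt
  have hFc : ∀ q, Continuous (F q) := fun q => (hbph.right q).continuous.mul hosc
  have hFdc : ∀ q, Continuous fun p => fderiv ℝ (fun x => F x p) q := by
    intro q
    have h1 : ∀ p, fderiv ℝ (fun x => F x p) q =
        oscInt u p • fderiv ℝ (fun x => b x p * phase p x 0) q := fun p =>
      fderiv_mul_const ((hbph.left p).contDiffAt.differentiableAt (by simp)) _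
    simp only [h1]
    refine hosc.smul ?_
    have h2 : ContDiff ℝ (⊤ : ℕ∞) (Function.uncurry fun p x : Vec n => b x p * phase p x 0) :=
      hbph.comp (contDiff_snd.prodMk contDiff_fst)
    exact (ContDiff.fderiv (n := 0) h2 contDiff_const (by simp)).continuous
  have main : ∀ q₀, HasFDerivAt (fun q => ∫ p, F q p)
      (∫ p, fderiv ℝ (fun x => F x p) q₀) q₀ ∧
      Integrable fun p => fderiv ℝ (fun x => F x p) q₀ := by
    intro q₀
    obtain ⟨C₀, N₀, h₀⟩ := (hb 0).weightedBound.exists_local_bound hpos hcont q₀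
    choose C N hCN using fun i =>
      (FiniteSymbol.opShift hpos hσ hb i 0).weightedBound.exists_local_bound hpos hcont q₀
    have hbound : ∀ q ∈ Metric.ball q₀ 1, ∀ p, ‖fderiv ℝ (fun x => F x p) q‖ ≤
        ∑ i, C i * ((1 + ‖p‖) ^ N i * ‖oscInt u p‖) := by
      intro q hq p
      refine (norm_clm_le_sum _).trans (Finset.sum_le_sum fun i _ => ?_)
      have h := pdC_integrand hs (oscInt u p) p q i
      rw [pdC] at h
      rw [h, norm_mul, norm_mul, norm_mul, norm_phase, Complex.norm_I, one_mul, mul_one,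
        ← mul_assoc]
      exact mul_le_mul_of_nonneg_right (hCN i q hq p) (norm_nonneg _)
    have hbi : Integrable fun p : Vec n => ∑ i, C i * ((1 + ‖p‖) ^ N i * ‖oscInt u p‖) :=
      integrable_finsetSum _ fun i _ => (integrable_pow_mul_oscInt (N i) hu hc).const_mul _
    have hq₀ : q₀ ∈ Metric.ball q₀ 1 := Metric.mem_ball_self one_pos
    refine ⟨hasFDerivAt_integral_of_dominated_of_fderiv_le (Metric.ball_mem_nhds q₀ one_pos)
      (Filter.Eventually.of_forall fun q => (hFc q).aestronglyMeasurable) ?_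
      (hFdc q₀).aestronglyMeasurable (Filter.Eventually.of_forall fun p q hq => hbound q hq p)
      hbi (Filter.Eventually.of_forall fun p q _ => hFd p q), ?_⟩
    · refine ((integrable_pow_mul_oscInt N₀ hu hc).const_mul C₀).mono'
        (hFc q₀).aestronglyMeasurable (Filter.Eventually.of_forall fun p => ?_)
      rw [hF, norm_mul, norm_mul, norm_phase, mul_one, ← mul_assoc]
      exact mul_le_mul_of_nonneg_right (h₀ q₀ hq₀ p) (norm_nonneg _)
    · exact hbi.mono' (hFdc q₀).aestronglyMeasurable
        (Filter.Eventually.of_forall fun p => hbound q₀ hq₀ p)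
  have hder : ∀ q, HasFDerivAt (OpSym b u) ((((2 * Real.pi) ^ (-(n : ℤ)) : ℝ) : ℂ) •
      ∫ p, fderiv ℝ (fun x => F x p) q) q := by
    intro q
    rw [show OpSym b u = _ from funext fun q => OpSym_eq_integral b u q]
    exact (main q).1.const_mul _
  refine ⟨fun q => (hder q).differentiableAt, fun i q => ?_⟩
  rw [pdC, (hder q).fderiv, smul_apply,
    ContinuousLinearMap.integral_apply (main q).2, OpSym_eq_integral, smul_eq_mul,
    mul_left_comm Complex.I]
  congr 1
  rw [← integral_const_mul]
  congr 1
  funext p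
  exact pdC_integrand hs (oscInt u p) p q i

theorem contDiff_OpSym (hpos : ∀ r, 0 < lam r) (hcont : Continuous lam) (hσ : σ ≤ 1)
    {k : ℤ} {m : ℝ} {b : Vec n → Vec n → ℂ} (hb : ∀ N, FiniteSymbol lam σ N k m b)
    {u : Vec n → ℂ} (hu : ContDiff ℝ (⊤ : ℕ∞) u) (hc : HasCompactSupport u) :
    ContDiff ℝ (⊤ : ℕ∞) (OpSym b u) := by
  rw [contDiff_infty]
  intro N
  induction N generalizing k m b with
  | zero =>
    rw [Nat.cast_zero, contDiff_zero]
    exact (differentiable_OpSym hpos hcont hσ hb hu hc).1.continuous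
  | succ N ih =>
    obtain ⟨hd, hp⟩ := differentiable_OpSym hpos hcont hσ hb hu hc
    rw [Nat.cast_succ, contDiff_succ_iff_fderiv_apply]
    refine ⟨hd, fun h => absurd h (by simp), fun y => ?_⟩
    have hy : (fun x => fderiv ℝ (OpSym b u) x y) = fun x =>
        ∑ i, y i • (Complex.I * OpSym (opShift i b) u x) := by
      funext x
      conv_lhs => rw [pi_eq_sum_univ' y]
      simp only [map_sum, map_smul, ← hp]
      rfl
    rw [hy]
    exact ContDiff.sum fun i _ => (contDiff_const.mul
      (ih (FiniteSymbol.opShift hpos hσ hb i))).const_smul (y i)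

theorem pdC_zero_iterate_OpSym (hlam : LogDerBounded lam) (hσ : σ ≤ 1) {m : ℝ}
    {b : Vec n → Vec n → ℂ} (hb : IsSymbol lam m σ b) {u : Vec n → ℂ}
    (hu : ContDiff ℝ (⊤ : ℕ∞) u) (hc : HasCompactSupport u) (c : ℕ) :
    (pdC 0)^[c] (OpSym b u) = fun q => Complex.I ^ c * OpSym (opRho^[c] b) u q := by
  induction c with
  | zero => simp
  | succ c ih =>
    have hbc := hb.opRho_iterate hlam.1 hσ c
    have hbN := isSymbol_iff_forall_finiteSymbol.1 hbc
    funext q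
    rw [Function.iterate_succ_apply', ih,
      pdC_mul contDiff_const (contDiff_OpSym hlam.1 hlam.2.1.continuous hσ hbN hu hc), pdC_const,
      (differentiable_OpSym hlam.1 hlam.2.1.continuous hσ hbN hu hc).2,
      Function.iterate_succ_apply', opRho_eq hbc.smooth]
    ring

theorem pdC_iterate_weight_mul_OpSym (hlam : LogDerBounded lam) (hσ : σ ≤ 1) {m : ℝ}
    {b : Vec n → Vec n → ℂ} (hb : IsSymbol lam m σ b) {u : Vec n → ℂ}
    (hu : ContDiff ℝ (⊤ : ℕ∞) u) (hc : HasCompactSupport u) {i : Fin n} (hi : i ≠ 0)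
    (z : ℂ) (s c : ℕ) :
    (pdC i)^[c] (fun q => z * ((lam (q 0) ^ s : ℝ) : ℂ) * OpSym b u q) = fun q =>
      z * Complex.I ^ c * ((lam (q 0) ^ (s + c) : ℝ) : ℂ) *
        OpSym ((opEta lam i)^[c] b) u q := by
  induction c with
  | zero => simp
  | succ c ih =>
    have hbc := hb.opEta_iterate hlam hσ hi c
    have hbN := isSymbol_iff_forall_finiteSymbol.1 hbc
    have hw : ContDiff ℝ (⊤ : ℕ∞) fun r => lam r ^ (s + c) := hlam.2.1.pow _
    funext q
    rw [Function.iterate_succ_apply', ih,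
      pdC_mul (contDiff_const.mul (contDiff_radial hw))
        (contDiff_OpSym hlam.1 hlam.2.1.continuous hσ hbN hu hc),
      pdC_mul contDiff_const (contDiff_radial hw), pdC_const, pdC_radial hw, if_neg hi,
      (differentiable_OpSym hlam.1 hlam.2.1.continuous hσ hbN hu hc).2,
      Function.iterate_succ_apply', opEta_eq hbc.smooth,
      OpSym_radial_mul (fun r => (lam r)⁻¹)]
    have h0 : ((lam (q 0) : ℝ) : ℂ) ≠ 0 := Complex.ofReal_ne_zero.2 (hlam.1 _).ne'
    push_cast
    field_simp
    ring

theorem foldr_pdC_OpSym (hlam : LogDerBounded lam) (hσ : σ ≤ 1) {m : ℝ}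
    {b : Vec n → Vec n → ℂ} (hb : IsSymbol lam m σ b) {u : Vec n → ℂ}
    (hu : ContDiff ℝ (⊤ : ℕ∞) u) (hc : HasCompactSupport u) (Γ : Fin n → ℕ) (z : ℂ)
    (l : List (Fin n)) :
    l.foldr (fun i g => if i = 0 then g else (pdC i)^[Γ i] g) (fun q => z * OpSym b u q) =
      fun q => z * Complex.I ^ (l.map fun i => if i = 0 then 0 else Γ i).sum *
        ((lam (q 0) ^ (l.map fun i => if i = 0 then 0 else Γ i).sum : ℝ) : ℂ) *
        OpSym (l.foldr (fun i g => if i = 0 then g else (opEta lam i)^[Γ i] g) b) u q := by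
  induction l with
  | nil => simp
  | cons i l ih =>
    simp only [List.foldr_cons, List.map_cons, List.sum_cons, ih]
    by_cases hi : i = 0
    · simp [hi]
    · simp only [hi, if_false]
      rw [pdC_iterate_weight_mul_OpSym hlam hσ (hb.foldr_opEta hlam hσ Γ l) hu hc hi]
      funext q
      rw [mul_assoc z, ← pow_add, add_comm (Γ i)]

omit [NeZero n] in
theorem mpd_add_single {f : Vec n → ℂ} (hf : ContDiff ℝ (⊤ : ℕ∞) f) (A : Fin n → ℕ) (i : Fin n)
    (c : ℕ) : mpd (A + Pi.single i c) f = mpd A ((pdC i)^[c] f) := by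
  induction c generalizing f with
  | zero => simp
  | succ c ih =>
    rw [Function.iterate_succ_apply, ← ih (contDiff_pdC hf i), Pi.single_add, ← add_assoc]
    unfold mpd
    rw [foldr_iterate_add_single (S := fun f : Vec n → ℂ => ContDiff ℝ (⊤ : ℕ∞) f)
      (fun i f hf => contDiff_pdC hf i)
      (fun i j f hf => funext fun x => fderiv_fderiv_apply_comm hf _ _ x) _ i _
      (List.nodup_finRange n) hf]
    simp

theorem mpd_eq_foldr_pdC_zero {f : Vec n → ℂ} (hf : ContDiff ℝ (⊤ : ℕ∞) f) (Γ : Fin n → ℕ) :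
    mpd Γ f = (List.finRange n).foldr (fun i g => if i = 0 then g else (pdC i)^[Γ i] g)
      ((pdC 0)^[Γ 0] f) := by
  have hΓ : Γ = Function.update Γ 0 0 + Pi.single 0 (Γ 0) := by
    funext i
    by_cases hi : i = 0
    · subst hi; simp
    · simp [hi]
  conv_lhs => rw [hΓ]
  rw [mpd_add_single hf, mpd]
  congr 1
  funext i g
  by_cases hi : i = 0
  · subst hi; simp
  · simp [hi]

end Differentiation

/-- **Proposition 4.4.**  Let `λ : ℝ → (0,∞)` be smooth with `∂_r^{j+1} log λ ∈ L^∞(ℝ)`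
for all `j ≥ 0`.  For every `b ∈ S^m_σ(λ)`, every multiindex `Γ = (γ₀, γ)` and every
`u ∈ C_c^∞(ℝⁿ)`,
`(λ⁻¹D_θ)^γ D_r^{γ₀} Op(b)u = Op((λ⁻¹η + λ⁻¹D_θ)^γ (ρ + D_r)^{γ₀} b)u`,
and the composed symbol belongs to `S^{m+|Γ|}_σ(λ)`. -/
theorem compose_diffop_Op
    (n : ℕ) [NeZero n] (lam : ℝ → ℝ) (hlam : LogDerBounded lam)
    (m σ : ℝ) (hσ : σ ∈ Set.Icc (0 : ℝ) 1)
    (b : Vec n → Vec n → ℂ) (hb : IsSymbol lam m σ b) (Γ : Fin n → ℕ) :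
    (∀ u : Vec n → ℂ, ContDiff ℝ (⊤ : ℕ∞) u → HasCompactSupport u →
      ∀ q : Vec n, wDf lam Γ (OpSym b u) q = OpSym (compSym lam Γ b) u q) ∧
    IsSymbol lam (m + (fullLen Γ : ℝ)) σ (compSym lam Γ b) := by
  refine ⟨fun u hu hc q => ?_, hb.compSym hlam hσ.2 Γ⟩
  rw [wDf, mpd_eq_foldr_pdC_zero (contDiff_OpSym hlam.1 hlam.2.1.continuous hσ.2
      (isSymbol_iff_forall_finiteSymbol.1 hb) hu hc), pdC_zero_iterate_OpSym hlam hσ.2 hb hu hc,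
    foldr_pdC_OpSym hlam hσ.2 (hb.opRho_iterate hlam.1 hσ.2 _) hu hc, ← angLen_eq_list_sum,
    ← pow_add, ← fullLen_eq, compSym]
  have h1 : ((lam (q 0) : ℝ) : ℂ) ≠ 0 := Complex.ofReal_ne_zero.2 (hlam.1 _).ne'
  have h2 := Complex.I_ne_zero
  simp only [zpow_neg, zpow_natCast, Complex.ofReal_inv, Complex.ofReal_pow]
  field_simp
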